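/- arXiv:1203.4885 — 6 statements merged into one kernel-verified Lean document; each statement's English description precedes it below -/
import Mathlib

section
/- Let I be a finite type and let A₀, A₁, R be positive semidefinite matrices in Matrix I I ℂ such that B₀ := A₀ − R and B₁ := A₁ + R are also positive semidefinite. Then for every n ≥ 1 and every k with 0 ≤ k ≤ n, the matrix (∑_{s ∈ Σ^n_{≥k}} ⨂ⱼ B_{s j}) − (∑_{s ∈ Σ^n_{≥k}} ⨂ⱼ A_{s j}) is positive semidefinite, i.e. ∑_{s ∈ Σ^n_{≥k}} ⨂ⱼ B_{s j} ≥ ∑_{s ∈ Σ^n_{≥k}} ⨂ⱼ A_{s j} in the Loewner order. -/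
open Matrix Finset ComplexOrder

/-- The `n`-fold Kronecker product of matrices `M 0, …, M (n-1)`, indexed by `Fin n → I`. -/
noncomputable def nKron {n : ℕ} {I : Type*} [Fintype I] (M : Fin n → Matrix I I ℂ) :
    Matrix (Fin n → I) (Fin n → I) ℂ :=
  fun f g => ∏ j, M j (f j) (g j)

/-- The set `Σ^n_{≥k}` of binary strings of length `n` with at least `k` ones. -/
def SigmaGe (n k : ℕ) : Finset (Fin n → Fin 2) :=
  Finset.univ.filter fun s => k ≤ (Finset.univ.filter fun j => s j = 1).card

lemma card_filter_cons_eq_one {n : ℕ} (a : Fin 2) (s : Fin n → Fin 2) :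
    (univ.filter fun j => (Fin.cons a s : Fin (n + 1) → Fin 2) j = 1).card =
      (if a = 1 then 1 else 0) + (univ.filter fun j => s j = 1).card := by
  simp only [Finset.card_filter, Fin.sum_univ_succ, Fin.cons_zero, Fin.cons_succ]

/-- Splitting a sum over `Σ^{n+1}_{≥k}` according to the first coordinate. -/
lemma sum_sigmaGe_succ {M : Type*} [AddCommMonoid M] (n k : ℕ)
    (F : (Fin (n + 1) → Fin 2) → M) :
    ∑ s ∈ SigmaGe (n + 1) k, F s =
      ∑ s ∈ SigmaGe n (k - 1), F (Fin.cons 1 s) + ∑ s ∈ SigmaGe n k, F (Fin.cons 0 s) := by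
  simp only [SigmaGe, Finset.sum_filter]
  rw [← (Fin.consEquiv fun _ => Fin 2).sum_comp, Fintype.sum_prod_type, Fin.sum_univ_two,
    add_comm]
  simp only [Fin.consEquiv_apply, card_filter_cons_eq_one, if_true, zero_ne_one, if_false,
    zero_add, tsub_le_iff_left]
  rfl

lemma sigmaGe_subset_of_le {n k l : ℕ} (h : k ≤ l) : SigmaGe n l ⊆ SigmaGe n k := by
  intro s hs
  simp only [SigmaGe, mem_filter, mem_univ, true_and] at hs ⊢
  exact h.trans hs

/-- The Kronecker product of a matrix with one indexed by `Fin n → I`, reindexed by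
`Fin (n + 1) → I`. -/
noncomputable def consKron {n : ℕ} {I : Type*} (M : Matrix I I ℂ)
    (N : Matrix (Fin n → I) (Fin n → I) ℂ) : Matrix (Fin (n + 1) → I) (Fin (n + 1) → I) ℂ :=
  (Matrix.kroneckerMap (· * ·) M N).submatrix (fun f => (f 0, Fin.tail f))
    fun f => (f 0, Fin.tail f)

lemma consKron_apply {n : ℕ} {I : Type*} (M : Matrix I I ℂ)
    (N : Matrix (Fin n → I) (Fin n → I) ℂ) (f g : Fin (n + 1) → I) :
    consKron M N f g = M (f 0) (g 0) * N (Fin.tail f) (Fin.tail g) := rfl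

lemma posSemidef_consKron {n : ℕ} {I : Type*} [Finite I] {M : Matrix I I ℂ}
    {N : Matrix (Fin n → I) (Fin n → I) ℂ} (hM : M.PosSemidef) (hN : N.PosSemidef) :
    (consKron M N).PosSemidef := by
  have := Fintype.ofFinite I
  exact (hM.kronecker hN).submatrix _

lemma nKron_succ {n : ℕ} {I : Type*} [Fintype I] (M : Fin (n + 1) → Matrix I I ℂ) :
    nKron M = consKron (M 0) (nKron fun j => M j.succ) := by
  ext f g
  simp only [nKron, consKron_apply, Fin.prod_univ_succ, Fin.tail]

lemma posSemidef_nKron {n : ℕ} {I : Type*} [Fintype I] {M : Fin n → Matrix I I ℂ}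
    (hM : ∀ j, (M j).PosSemidef) : (nKron M).PosSemidef := by
  induction n with
  | zero =>
    classical
    convert Matrix.PosSemidef.one (n := Fin 0 → I) (R := ℂ) using 1
    ext f g
    simp [nKron, Matrix.one_apply, Subsingleton.elim f g]
  | succ n ih =>
    rw [nKron_succ]
    exact posSemidef_consKron (hM 0) (ih fun j => hM j.succ)

/-- The sum over `s ∈ Σ^n_{≥k}` of the products `⨂ⱼ A_{s j}`. -/
noncomputable def thresholdSum {I : Type*} [Fintype I] (A₀ A₁ : Matrix I I ℂ) (n k : ℕ) :
    Matrix (Fin n → I) (Fin n → I) ℂ :=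
  ∑ s ∈ SigmaGe n k, nKron fun j => if s j = 1 then A₁ else A₀

lemma thresholdSum_succ {I : Type*} [Fintype I] (A₀ A₁ : Matrix I I ℂ) (n k : ℕ) :
    thresholdSum A₀ A₁ (n + 1) k =
      consKron A₁ (thresholdSum A₀ A₁ n (k - 1)) + consKron A₀ (thresholdSum A₀ A₁ n k) := by
  ext f g
  simp only [thresholdSum, sum_sigmaGe_succ, nKron_succ, Fin.cons_zero, Fin.cons_succ, if_true,
    zero_ne_one, if_false, Matrix.add_apply, Matrix.sum_apply, consKron_apply, Finset.mul_sum]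

lemma posSemidef_thresholdSum_sub_of_le {I : Type*} [Fintype I] {A₀ A₁ : Matrix I I ℂ}
    (hA₀ : A₀.PosSemidef) (hA₁ : A₁.PosSemidef) (n : ℕ) {k l : ℕ} (h : k ≤ l) :
    (thresholdSum A₀ A₁ n k - thresholdSum A₀ A₁ n l).PosSemidef := by
  rw [thresholdSum, thresholdSum, ← Finset.sum_sdiff (sigmaGe_subset_of_le h),
    add_sub_cancel_right]
  refine Matrix.posSemidef_sum _ fun s _ => posSemidef_nKron fun j => ?_
  split_ifs
  exacts [hA₁, hA₀]

lemma posSemidef_thresholdSum_sub {I : Type*} [Fintype I] {A₀ A₁ R : Matrix I I ℂ}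
    (hA₀ : A₀.PosSemidef) (hA₁ : A₁.PosSemidef) (hR : R.PosSemidef)
    (hB₀ : (A₀ - R).PosSemidef) (n k : ℕ) :
    (thresholdSum (A₀ - R) (A₁ + R) n k - thresholdSum A₀ A₁ n k).PosSemidef := by
  induction n generalizing k with
  | zero =>
    convert Matrix.PosSemidef.zero (n := Fin 0 → I) (R := ℂ) using 1
    ext f g
    simp [thresholdSum, nKron, Matrix.sum_apply]
  | succ n ih =>
    convert ((posSemidef_consKron (hA₁.add hR) (ih (k - 1))).add
      (posSemidef_consKron hB₀ (ih k))).add (posSemidef_consKron hR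
        (posSemidef_thresholdSum_sub_of_le hA₀ hA₁ n (Nat.sub_le k 1))) using 1
    ext f g
    simp only [thresholdSum_succ, Matrix.add_apply, Matrix.sub_apply, consKron_apply]
    ring

theorem stmt0 {I : Type*} [Fintype I] [DecidableEq I]
    (A₀ A₁ R : Matrix I I ℂ)
    (hA₀ : A₀.PosSemidef) (hA₁ : A₁.PosSemidef) (hR : R.PosSemidef)
    (hB₀ : (A₀ - R).PosSemidef) (hB₁ : (A₁ + R).PosSemidef)
    (n : ℕ) (hn : 1 ≤ n) (k : ℕ) (hk : k ≤ n) :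
    ((∑ s ∈ SigmaGe n k, nKron (fun j => if s j = 1 then A₁ + R else A₀ - R))
      - (∑ s ∈ SigmaGe n k, nKron (fun j => if s j = 1 then A₁ else A₀))).PosSemidef := by
  exact posSemidef_thresholdSum_sub hA₀ hA₁ hR hB₀ n k
end

section
/- Let ι and I be finite types, let P : ι → Matrix I I ℂ be a family of positive semidefinite matrices, let v : ι → ℝ, let B := ∑_i P i, and let A be a Hermitian matrix with A ≥ ∑_i (v i) • P i in the Loewner order. Then for every n ≥ 1: ∑_{m : Fin n} ⨂ⱼ (if j = m then A else B) ≥ ∑_{s : Fin n → ι} (∑ⱼ v (s j)) • ⨂ⱼ P (s j) in the Loewner order. -/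
open Matrix Finset ComplexOrder

section nKron

variable {n : ℕ} {I : Type*} [Fintype I]

theorem nKron_mul (M N : Fin n → Matrix I I ℂ) :
    nKron (fun j => M j * N j) = nKron M * nKron N := by
  ext f g
  simp only [nKron, mul_apply, ← Finset.prod_mul_distrib, Fintype.prod_sum]

theorem nKron_conjTranspose (M : Fin n → Matrix I I ℂ) :
    nKron (fun j => (M j)ᴴ) = (nKron M)ᴴ := by
  ext f g
  simp [nKron, conjTranspose_apply]

theorem nKron_posSemidef [DecidableEq I] {M : Fin n → Matrix I I ℂ}
    (hM : ∀ j, (M j).PosSemidef) : (nKron M).PosSemidef := by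
  have hfactor (j : Fin n) : ∃ S : Matrix I I ℂ, M j = Sᴴ * S := by
    open scoped MatrixOrder in
    exact CStarAlgebra.nonneg_iff_eq_star_mul_self.mp (hM j).nonneg
  choose S hS using hfactor
  obtain rfl : M = fun j => (S j)ᴴ * S j := funext hS
  rw [nKron_mul, nKron_conjTranspose]
  exact posSemidef_conjTranspose_mul_self _

theorem nKron_sum {ι : Type*} [Fintype ι] (M : Fin n → ι → Matrix I I ℂ) :
    nKron (fun j => ∑ i, M j i) = ∑ s : Fin n → ι, nKron (fun j => M j (s j)) := by
  ext f g
  simp only [nKron, Matrix.sum_apply, Fintype.prod_sum]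

theorem nKron_smul (c : Fin n → ℂ) (M : Fin n → Matrix I I ℂ) :
    nKron (fun j => c j • M j) = (∏ j, c j) • nKron M := by
  ext f g
  simp [nKron, Finset.prod_mul_distrib]

theorem nKron_ite_sub (m : Fin n) (A B C : Matrix I I ℂ) :
    nKron (fun j => if j = m then A - C else B) =
      nKron (fun j => if j = m then A else B) - nKron (fun j => if j = m then C else B) := by
  rw [eq_sub_iff_add_eq]
  ext f g
  simp only [nKron, Matrix.add_apply]
  refine Finset.prod_add_prod_eq (Finset.mem_univ m) (by simp) ?_ ?_ <;>
    · intro j _ hj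
      simp [hj]

theorem sum_smul_nKron {ι : Type*} [Fintype ι] (P : ι → Matrix I I ℂ) (v : ι → ℂ) :
    ∑ s : Fin n → ι, (∑ j, v (s j)) • nKron (fun j => P (s j)) =
      ∑ m : Fin n, nKron (fun j => if j = m then ∑ i, v i • P i else ∑ i, P i) := by
  have key (m : Fin n) : nKron (fun j => if j = m then ∑ i, v i • P i else ∑ i, P i) =
      ∑ s : Fin n → ι, v (s m) • nKron (fun j => P (s j)) := by
    have h : (fun j => if j = m then ∑ i, v i • P i else ∑ i, P i) =
        fun j => ∑ i, (if j = m then v i else 1) • P i := by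
      funext j
      split_ifs <;> simp
    simp only [h, nKron_sum, nKron_smul, Finset.prod_ite_eq', Finset.mem_univ, if_true]
  simp_rw [key, Finset.sum_smul]
  exact Finset.sum_comm

end nKron

theorem stmt3 {ι I : Type*} [Fintype ι] [Fintype I] [DecidableEq I]
    (P : ι → Matrix I I ℂ) (hP : ∀ i, (P i).PosSemidef)
    (v : ι → ℝ) (B : Matrix I I ℂ) (hB : B = ∑ i, P i)
    (A : Matrix I I ℂ) (hA : A.IsHermitian)
    (hAv : (A - ∑ i, (v i : ℂ) • P i).PosSemidef)
    (n : ℕ) (hn : 1 ≤ n) :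
    ((∑ m : Fin n, nKron (fun j => if j = m then A else B))
      - (∑ s : Fin n → ι, ((∑ j, v (s j) : ℝ) : ℂ) • nKron (fun j => P (s j)))).PosSemidef := by
  subst hB
  simp only [Complex.ofReal_sum]
  rw [sum_smul_nKron P fun i => (v i : ℂ), ← Finset.sum_sub_distrib]
  refine posSemidef_sum _ fun m _ => ?_
  rw [← nKron_ite_sub]
  refine nKron_posSemidef fun j => ?_
  split_ifs
  · exact hAv
  · exact posSemidef_sum _ fun i _ => hP i
end

section
/- Let c := cos(π/8) and s := sin(π/8), and define v : Fin 2 × Fin 2 → ℂ by v (0,0) = c, v (1,1) = s, and v = 0 on the other two coordinates. (a) For every positive semidefinite σ : Matrix (Fin 2 × Fin 2) (Fin 2 × Fin 2) ℂ satisfying ∑_{y : Fin 2} σ (y,z) (y,z') = (if z = z' then (1:ℂ)/2 else 0) for all z z' : Fin 2, one has re (∑_{p,q} conj (v p) * σ p q * v q) ≤ cos(π/8)^2. (b) For u : Fin 2 × Fin 2 → ℂ given by u (y,z) = (if y = z then 1/√2 else 0) and σ := (fun p q => u p * conj (u q)), the constraint in (a) holds and re (∑_{p,q} conj (v p) * σ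 p q * v q) = cos(π/8)^2. Hence the optimal winning probability of a single repetition of the interaction is exactly cos²(π/8). -/
open Matrix Finset Real ComplexOrder

/-- The winning measurement vector `v = cos(π/8)|00⟩ + sin(π/8)|11⟩`. -/
noncomputable def winVec : Fin 2 × Fin 2 → ℂ := fun p =>
  if p = (0, 0) then (Real.cos (Real.pi / 8) : ℂ)
  else if p = (1, 1) then (Real.sin (Real.pi / 8) : ℂ)
  else 0

/-- The maximally entangled question state `u = (|00⟩ + |11⟩)/√2`. -/
noncomputable def meVec : Fin 2 × Fin 2 → ℂ := fun p =>
  if p.1 = p.2 then (1 / Real.sqrt 2 : ℂ) else 0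

/-- The off-diagonal entries of a positive semidefinite matrix are controlled by the diagonal. -/
theorem Matrix.PosSemidef.re_add_re_le {n : Type*} [Fintype n] [DecidableEq n]
    {σ : Matrix n n ℂ} (hσ : σ.PosSemidef) (i j : n) :
    (σ i j).re + (σ j i).re ≤ (σ i i).re + (σ j j).re := by
  have h := (Complex.le_def.mp
    (hσ.dotProduct_mulVec_nonneg (Pi.single i 1 - Pi.single j 1))).1
  simp [Matrix.mulVec_sub, sub_dotProduct] at h
  linarith

theorem two_mul_sin_mul_cos_pi_div_eight :
    2 * Real.sin (Real.pi / 8) * Real.cos (Real.pi / 8) =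
      Real.cos (Real.pi / 8) ^ 2 - Real.sin (Real.pi / 8) ^ 2 := by
  rw [← Real.sin_two_mul, ← Real.cos_two_mul', show 2 * (Real.pi / 8) = Real.pi / 4 by ring,
    Real.sin_pi_div_four, Real.cos_pi_div_four]

/-- The quadratic form of `winVec` only sees the block of `σ` spanned by `|00⟩` and `|11⟩`. -/
theorem re_sum_winVec (σ : Matrix (Fin 2 × Fin 2) (Fin 2 × Fin 2) ℂ) :
    (∑ p : Fin 2 × Fin 2, ∑ q : Fin 2 × Fin 2,
        (starRingEnd ℂ) (winVec p) * σ p q * winVec q).re =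
      Real.cos (Real.pi / 8) ^ 2 * (σ (0, 0) (0, 0)).re +
        Real.sin (Real.pi / 8) ^ 2 * (σ (1, 1) (1, 1)).re +
        Real.sin (Real.pi / 8) * Real.cos (Real.pi / 8) *
          ((σ (0, 0) (1, 1)).re + (σ (1, 1) (0, 0)).re) := by
  simp only [Fintype.sum_prod_type, Fin.sum_univ_two, winVec, Prod.mk.injEq, zero_ne_one,
    one_ne_zero, and_true, and_false, if_true, if_false, Complex.conj_ofReal, map_zero,
    zero_mul, mul_zero, add_zero, zero_add, Complex.add_re, Complex.re_mul_ofReal,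
    Complex.re_ofReal_mul]
  ring

/-- Each entry of `meVec` pairs with its conjugate to `1/2` on the diagonal. -/
theorem meVec_mul_conj (p q : Fin 2 × Fin 2) :
    meVec p * (starRingEnd ℂ) (meVec q) =
      if p.1 = p.2 ∧ q.1 = q.2 then (1 : ℂ) / 2 else 0 := by
  have h : (Real.sqrt 2 : ℂ) * Real.sqrt 2 = 2 := by
    exact_mod_cast Real.mul_self_sqrt (by norm_num : (0 : ℝ) ≤ 2)
  by_cases hp : p.1 = p.2 <;> by_cases hq : q.1 = q.2 <;>
    simp [meVec, hp, hq, ← mul_inv, h]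

theorem stmt5 :
    (∀ σ : Matrix (Fin 2 × Fin 2) (Fin 2 × Fin 2) ℂ, σ.PosSemidef →
      (∀ z z' : Fin 2, ∑ y : Fin 2, σ (y, z) (y, z') = if z = z' then (1 : ℂ) / 2 else 0) →
      (∑ p : Fin 2 × Fin 2, ∑ q : Fin 2 × Fin 2,
          (starRingEnd ℂ) (winVec p) * σ p q * winVec q).re ≤ Real.cos (Real.pi / 8) ^ 2)
    ∧ (∀ z z' : Fin 2,
        ∑ y : Fin 2, (meVec (y, z) * (starRingEnd ℂ) (meVec (y, z'))) =
          if z = z' then (1 : ℂ) / 2 else 0)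
    ∧ (∑ p : Fin 2 × Fin 2, ∑ q : Fin 2 × Fin 2,
        (starRingEnd ℂ) (winVec p) * (meVec p * (starRingEnd ℂ) (meVec q)) * winVec q).re =
          Real.cos (Real.pi / 8) ^ 2 := by
  have hcs := two_mul_sin_mul_cos_pi_div_eight
  refine ⟨fun σ hσ htr => ?_, fun z z' => ?_, ?_⟩
  · have hs : 0 ≤ Real.sin (Real.pi / 8) :=
      (Real.sin_pos_of_pos_of_lt_pi (by positivity) (by linarith [Real.pi_pos])).le
    have hc : 0 ≤ Real.cos (Real.pi / 8) :=
      Real.cos_nonneg_of_mem_Icc ⟨by linarith [Real.pi_pos], by linarith [Real.pi_pos]⟩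
    have hdiag (p : Fin 2 × Fin 2) : 0 ≤ (σ p p).re := (Complex.le_def.mp hσ.diag_nonneg).1
    have hoff := hσ.re_add_re_le (0, 0) (1, 1)
    have h0 := congrArg Complex.re (htr 0 0)
    have h1 := congrArg Complex.re (htr 1 1)
    simp only [Fin.sum_univ_two, Complex.add_re, if_true, one_div, Complex.inv_re,
      Complex.re_ofNat, Complex.normSq_ofNat] at h0 h1
    have hA : (σ (0, 0) (0, 0)).re ≤ 1 / 2 := by linarith [hdiag (1, 0)]
    have hB : (σ (1, 1) (1, 1)).re ≤ 1 / 2 := by linarith [hdiag (0, 1)]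
    rw [re_sum_winVec]
    have hsc := mul_nonneg hs hc
    have h₁ := mul_le_mul_of_nonneg_left hoff hsc
    have h₂ := mul_le_mul_of_nonneg_left hA (add_nonneg (sq_nonneg (Real.cos (Real.pi / 8))) hsc)
    have h₃ := mul_le_mul_of_nonneg_left hB (add_nonneg (sq_nonneg (Real.sin (Real.pi / 8))) hsc)
    linarith
  · simp only [meVec_mul_conj, Fin.sum_univ_two]
    fin_cases z <;> fin_cases z' <;> simp
  · rw [re_sum_winVec fun p q => meVec p * (starRingEnd ℂ) (meVec q)]
    simp only [meVec_mul_conj, and_self, if_true, one_div, Complex.inv_re,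
      Complex.re_ofNat, Complex.normSq_ofNat]
    linarith
end

section
/- Let d be a finite nonempty type and let v, w : d → ℂ satisfy ∑_p ‖v p‖² = 1, ∑_p ‖w p‖² = 1, and ∑_p conj (v p) * w p = 0 (v and w are orthonormal). Let Π₁ : Matrix d d ℂ be Π₁ p q = v p * conj (v q) and Π₀ := 1 − Π₁, and define ψ : d × d → ℂ by ψ (p,q) = (v p * w q + w p * v q)/√2. Then ∑_{r} ‖ψ r‖² = 1, and (Π₁ ⊗ₖ Π₀ + Π₀ ⊗ₖ Π₁).mulVec ψ = ψ. In particular, measuring each factor with {Π₀, Π₁} on the state ψ yields exactly one winning outcome with certainty. -/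
open Matrix Finset Kronecker

theorem Fintype.sum_prod_mul {d R : Type*} [Fintype d] [CommSemiring R] (f g : d → R) :
    ∑ r : d × d, f r.1 * g r.2 = (∑ p, f p) * ∑ q, g q := by
  rw [Fintype.sum_prod_type, Finset.sum_mul_sum]

theorem Matrix.kronecker_mulVec_mul {d R : Type*} [Fintype d] [CommSemiring R]
    (A B : Matrix d d R) (x y : d → R) :
    (A ⊗ₖ B).mulVec (fun r => x r.1 * y r.2) =
      fun r => A.mulVec x r.1 * B.mulVec y r.2 := by
  ext r
  simp only [Matrix.mulVec, dotProduct, Matrix.kroneckerMap_apply]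
  rw [← Fintype.sum_prod_mul]
  exact Finset.sum_congr rfl fun _ _ => by ring

theorem Complex.sum_conj_mul_self {d : Type*} [Fintype d] (v : d → ℂ) :
    ∑ p, (starRingEnd ℂ) (v p) * v p = ((∑ p, ‖v p‖ ^ 2 : ℝ) : ℂ) := by
  push_cast
  exact Finset.sum_congr rfl fun p _ => Complex.conj_mul' (v p)

theorem stmt7 {d : Type*} [Fintype d] [DecidableEq d] [Nonempty d]
    (v w : d → ℂ)
    (hv : ∑ p, ‖v p‖ ^ 2 = 1) (hw : ∑ p, ‖w p‖ ^ 2 = 1)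
    (hvw : ∑ p, (starRingEnd ℂ) (v p) * w p = 0)
    (Pi1 Pi0 : Matrix d d ℂ)
    (hPi1 : Pi1 = Matrix.of fun p q => v p * (starRingEnd ℂ) (v q))
    (hPi0 : Pi0 = 1 - Pi1)
    (ψ : d × d → ℂ)
    (hψ : ψ = fun r => (v r.1 * w r.2 + w r.1 * v r.2) / Real.sqrt 2) :
    (∑ r : d × d, ‖ψ r‖ ^ 2 = 1) ∧
      (Pi1 ⊗ₖ Pi0 + Pi0 ⊗ₖ Pi1).mulVec ψ = ψ := by
  have hvv : ∑ p, (starRingEnd ℂ) (v p) * v p = 1 := by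
    rw [Complex.sum_conj_mul_self, hv, Complex.ofReal_one]
  have hww : ∑ p, (starRingEnd ℂ) (w p) * w p = 1 := by
    rw [Complex.sum_conj_mul_self, hw, Complex.ofReal_one]
  constructor
  · have hsqrt : (Real.sqrt 2 : ℂ)⁻¹ * (Real.sqrt 2 : ℂ)⁻¹ = 1 / 2 := by
      rw [← mul_inv, ← Complex.ofReal_mul, Real.mul_self_sqrt zero_le_two]
      norm_num
    have hexp : ∀ r : d × d, (starRingEnd ℂ) (ψ r) * ψ r = 1 / 2 *
        (((starRingEnd ℂ) (v r.1) * v r.1) * ((starRingEnd ℂ) (w r.2) * w r.2)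
        + ((starRingEnd ℂ) (v r.1) * w r.1) * ((starRingEnd ℂ) (w r.2) * v r.2)
        + ((starRingEnd ℂ) (w r.1) * v r.1) * ((starRingEnd ℂ) (v r.2) * w r.2)
        + ((starRingEnd ℂ) (w r.1) * w r.1) * ((starRingEnd ℂ) (v r.2) * v r.2)) := by
      intro r
      simp only [hψ, ← hsqrt, div_eq_mul_inv, map_mul, map_add, map_inv₀, Complex.conj_ofReal]
      ring
    have hsum : ((∑ r : d × d, ‖ψ r‖ ^ 2 : ℝ) : ℂ) = 1 := by
      rw [← Complex.sum_conj_mul_self]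
      simp only [hexp]
      rw [← Finset.mul_sum]
      simp only [Finset.sum_add_distrib]
      rw [Fintype.sum_prod_mul (fun p => (starRingEnd ℂ) (v p) * v p)
          (fun p => (starRingEnd ℂ) (w p) * w p),
        Fintype.sum_prod_mul (fun p => (starRingEnd ℂ) (v p) * w p)
          (fun p => (starRingEnd ℂ) (w p) * v p),
        Fintype.sum_prod_mul (fun p => (starRingEnd ℂ) (w p) * v p)
          (fun p => (starRingEnd ℂ) (v p) * w p),
        Fintype.sum_prod_mul (fun p => (starRingEnd ℂ) (w p) * w p)
          (fun p => (starRingEnd ℂ) (v p) * v p), hvv, hww, hvw]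
      norm_num
    exact_mod_cast hsum
  · have hPi1_apply : ∀ x : d → ℂ,
        Pi1.mulVec x = (∑ q, (starRingEnd ℂ) (v q) * x q) • v := by
      intro x
      ext p
      simp only [hPi1, Matrix.mulVec, dotProduct, Matrix.of_apply, Pi.smul_apply, smul_eq_mul,
        Finset.sum_mul]
      exact Finset.sum_congr rfl fun _ _ => by ring
    have h1v : Pi1.mulVec v = v := by rw [hPi1_apply, hvv, one_smul]
    have h1w : Pi1.mulVec w = 0 := by rw [hPi1_apply, hvw, zero_smul]
    have h0v : Pi0.mulVec v = 0 := by
      rw [hPi0, Matrix.sub_mulVec, Matrix.one_mulVec, h1v, sub_self]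
    have h0w : Pi0.mulVec w = w := by
      rw [hPi0, Matrix.sub_mulVec, Matrix.one_mulVec, h1w, sub_zero]
    have hψ' : ψ = (Real.sqrt 2 : ℂ)⁻¹ •
        ((fun r : d × d => v r.1 * w r.2) + fun r : d × d => w r.1 * v r.2) := by
      ext r
      simp only [hψ, Pi.smul_apply, Pi.add_apply, smul_eq_mul, div_eq_inv_mul]
    rw [hψ', Matrix.mulVec_smul, Matrix.add_mulVec, Matrix.mulVec_add, Matrix.mulVec_add]
    simp only [Matrix.kronecker_mulVec_mul, h1v, h1w, h0v, h0w]
    congr 1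
    ext r
    simp
end

section
/- Let c := cos(π/8), s := sin(π/8), and v : Fin 2 × Fin 2 → ℂ with v (0,0) = c, v (1,1) = s, v = 0 otherwise. Let Π₁ : Matrix (Fin 2 × Fin 2) (Fin 2 × Fin 2) ℂ be Π₁ p q = v p * conj (v q) and Π₀ := 1 − Π₁. Let ψ : (Fin 2 × Fin 2) × (Fin 2 × Fin 2) → ℂ be ψ ((0,0),(0,0)) = −1/2, ψ ((0,0),(1,1)) = 1/2, ψ ((1,1),(0,0)) = 1/2, ψ ((1,1),(1,1)) = 1/2, ψ = 0 otherwise. Then re (∑_{r, r'} conj (ψ r) * (Π₁ ⊗ₖ Π₀ + Π₀ ⊗ₖ Π₁) r r' * ψ r') = 1. Hence, although the optimal winning probability for a single repetition is cos²(π/8) < 1, Bob wins exactly one of the two parallel repetitions with certainty. -/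
open Matrix Finset Kronecker

/-- The projection onto the winning vector. -/
noncomputable def projWin : Matrix (Fin 2 × Fin 2) (Fin 2 × Fin 2) ℂ :=
  Matrix.of fun p q => winVec p * (starRingEnd ℂ) (winVec q)

/-- The projection onto the orthogonal complement of the winning vector. -/
noncomputable def projLose : Matrix (Fin 2 × Fin 2) (Fin 2 × Fin 2) ℂ :=
  1 - projWin

/-- The state after Bob's phase flip on two copies of the maximally entangled state. -/
noncomputable def flipVec : (Fin 2 × Fin 2) × (Fin 2 × Fin 2) → ℂ := fun r =>
  if r = ((0, 0), (0, 0)) then (-1 : ℂ) / 2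
  else if r = ((0, 0), (1, 1)) then (1 : ℂ) / 2
  else if r = ((1, 1), (0, 0)) then (1 : ℂ) / 2
  else if r = ((1, 1), (1, 1)) then (1 : ℂ) / 2
  else 0

theorem cos_sq_sub_sin_sq_pi_div_eight :
    Real.cos (Real.pi / 8) ^ 2 - Real.sin (Real.pi / 8) ^ 2 =
      2 * Real.sin (Real.pi / 8) * Real.cos (Real.pi / 8) := by
  rw [← Real.cos_two_mul', ← Real.sin_two_mul, show 2 * (Real.pi / 8) = Real.pi / 4 by ring,
    Real.cos_pi_div_four, Real.sin_pi_div_four]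

theorem stmt9 :
    (∑ r : (Fin 2 × Fin 2) × (Fin 2 × Fin 2), ∑ r' : (Fin 2 × Fin 2) × (Fin 2 × Fin 2),
        (starRingEnd ℂ) (flipVec r) *
          (projWin ⊗ₖ projLose + projLose ⊗ₖ projWin) r r' * flipVec r').re = 1 := by
  have h₁ : (Real.sin (Real.pi / 8) : ℂ) ^ 2 + (Real.cos (Real.pi / 8) : ℂ) ^ 2 = 1 :=
    mod_cast Real.sin_sq_add_cos_sq (Real.pi / 8)
  have h₂ : (Real.cos (Real.pi / 8) : ℂ) ^ 2 - (Real.sin (Real.pi / 8) : ℂ) ^ 2 =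
      2 * (Real.sin (Real.pi / 8) : ℂ) * (Real.cos (Real.pi / 8) : ℂ) :=
    mod_cast cos_sq_sub_sin_sq_pi_div_eight
  rw [← Complex.one_re]
  congr 1
  simp only [Fintype.sum_prod_type, Fin.sum_univ_two, flipVec, projLose, projWin, winVec,
    Matrix.add_apply, Matrix.kroneckerMap_apply, Matrix.sub_apply, Matrix.of_apply,
    Matrix.one_apply]
  generalize Real.cos (Real.pi / 8) = c at *
  generalize Real.sin (Real.pi / 8) = s at *
  simp only [Prod.mk.injEq, zero_ne_one, one_ne_zero, and_true, and_false,
    and_self, if_true, if_false, map_zero, map_one, map_neg, map_div₀, Complex.conj_ofReal,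
    map_ofNat]
  linear_combination h₁ - (1 / 2) * ((c : ℂ) ^ 2 - (s : ℂ) ^ 2 - 2 * s * c) * h₂
end

section
/- Let H : ℝ → ℝ be the binary entropy H(x) = −x * logb 2 x − (1−x) * logb 2 (1−x) (with H(1) = 0). Then for every real α with 0 < α ≤ 1: 2 ^ (−H(α)/α) > α / 3. -/
open Real

/-- The binary entropy function `H(x) = −x·log₂ x − (1−x)·log₂(1−x)`. -/
noncomputable def binEnt (x : ℝ) : ℝ :=
  -x * Real.logb 2 x - (1 - x) * Real.logb 2 (1 - x)

theorem stmt15 (α : ℝ) (hα0 : 0 < α) (hα1 : α ≤ 1) :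
    (2 : ℝ) ^ (-(binEnt α) / α) > α / 3 := by
  have hlog2 : Real.log 2 ≠ 0 := (Real.log_pos one_lt_two).ne'
  have hlog3 : 1 < Real.log 3 := by
    rw [Real.lt_log_iff_exp_lt (by norm_num)]
    linarith [Real.exp_one_lt_d9]
  have hbound : -α ≤ (1 - α) * Real.log (1 - α) := by
    rcases hα1.eq_or_lt with rfl | h
    · norm_num
    · have hpos : 0 < 1 - α := sub_pos.2 h
      have := mul_le_mul_of_nonneg_left (Real.one_sub_inv_le_log_of_pos hpos) hpos.le
      rw [mul_sub, mul_inv_cancel₀ hpos.ne'] at this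
      linarith
  have hexp : Real.log 2 * (-(binEnt α) / α) =
      Real.log α + (1 - α) * Real.log (1 - α) / α := by
    simp only [binEnt, Real.logb]
    field_simp
    ring
  have hdiv : -1 ≤ (1 - α) * Real.log (1 - α) / α := by
    rw [le_div_iff₀ hα0]
    linarith
  rw [gt_iff_lt, Real.rpow_def_of_pos two_pos, hexp,
    ← Real.log_lt_iff_lt_exp (by positivity), Real.log_div hα0.ne' three_ne_zero]
  linarith
end
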